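/- For every splitting V_D ⊆ V, the set C = {D} ∪ (V_D ∖ ∂) ∪ {p′ : p ∈ V_D ∩ P}, where ∂ = {p ∈ V_D ∩ P : some child of p lies in V_S}, is an s-t cut of G′ whose value satisfies T_{G′}(C) = T(V_D). Consequently the minimum s-t cut value of G′ is at most the minimum training delay over all splittings. (Cut-correspondence half of the proof of Theorem 1, covering cases 1 and 3.) -/

import Mathlib

open Finset

attribute [local instance] Classical.propDecidable

/-- Split-learning delay model: layers `V`, directed edges `E` (child consumes
parent's output), iteration count `N`, transmission rates `RD` (device→server)
and `RS` (server→device), per-layer device/server computation delays `xiD`/`xiS`,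
parameter size `k`, and smashed-data size `a`. -/
structure SLModel (V : Type) where
  E : Finset (V × V)
  N : ℝ
  RD : ℝ
  RS : ℝ
  xiD : V → ℝ
  xiS : V → ℝ
  k : V → ℝ
  a : V → ℝ

/-- The standing hypotheses: positive `N`, `RD`, `RS`, nonnegative per-layer
parameters, and `E` is acyclic (admits a topological ordering). -/
def SLModel.Valid {V : Type} (M : SLModel V) : Prop :=
  0 < M.N ∧ 0 < M.RD ∧ 0 < M.RS ∧ (∀ v, 0 ≤ M.xiD v) ∧ (∀ v, 0 ≤ M.xiS v) ∧
    (∀ v, 0 ≤ M.k v) ∧ (∀ v, 0 ≤ M.a v) ∧ ∃ f : V → ℕ, ∀ e ∈ M.E, f e.1 < f e.2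

/-- Boundary set `V_c` of a splitting `VD`: device layers with a child on the server. -/
noncomputable def SLModel.boundary {V : Type} (M : SLModel V) (VD : Finset V) : Finset V :=
  VD.filter (fun v => ∃ u, (v, u) ∈ M.E ∧ u ∉ VD)

/-- Training delay `T(V_D)` of a splitting. -/
noncomputable def SLModel.T {V : Type} [Fintype V] (M : SLModel V) (VD : Finset V) : ℝ :=
  M.N * ((∑ v ∈ VD, M.xiD v) + (∑ v ∈ M.boundary VD, M.a v / M.RD)
      + (∑ v ∈ Finset.univ \ VD, M.xiS v) + (∑ v ∈ M.boundary VD, M.a v / M.RS))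
    + (∑ v ∈ VD, M.k v / M.RD) + (∑ v ∈ VD, M.k v / M.RS)

/-- Number of children of `v` under `E`. -/
noncomputable def childCount {V : Type} (M : SLModel V) (v : V) : ℕ :=
  (M.E.filter (fun e => e.1 = v)).card

/-- `P`: the set of parent vertices with at least two children. -/
noncomputable def Pset {V : Type} [Fintype V] (M : SLModel V) : Finset V :=
  Finset.univ.filter (fun p => 2 ≤ childCount M p)

/-- Nodes of the restructured DAG `G'`: layer `v`, auxiliary vertex `p'`
(meaningful for `p ∈ P`), source `D`, sink `S`. -/
def layerN {V : Type} (v : V) : V ⊕ V ⊕ Bool := Sum.inl v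

def auxN {V : Type} (p : V) : V ⊕ V ⊕ Bool := Sum.inr (Sum.inl p)

def srcN {V : Type} : V ⊕ V ⊕ Bool := Sum.inr (Sum.inr false)

def snkN {V : Type} : V ⊕ V ⊕ Bool := Sum.inr (Sum.inr true)

/-- Weighted edges of the restructured DAG `G'`: for each `p ∈ P` all edges of
`G` into `p` are redirected into `p'`, the edge `(p, S)` becomes `(p', S)`, and a
new edge `(p', p)` carries `p`'s propagation weight; all other edges of `G` are
kept unchanged.  `wG' M x y` is the weight of the edge `(x, y)` (0 if absent). -/
noncomputable def wG' {V : Type} [Fintype V] (M : SLModel V) :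
    (V ⊕ V ⊕ Bool) → (V ⊕ V ⊕ Bool) → ℝ
  | Sum.inl u, Sum.inl v =>
      if (u, v) ∈ M.E ∧ v ∉ Pset M then M.N * (M.a u / M.RD + M.a u / M.RS) else 0
  | Sum.inl u, Sum.inr (Sum.inl v) =>
      if (u, v) ∈ M.E ∧ v ∈ Pset M then M.N * (M.a u / M.RD + M.a u / M.RS) else 0
  | Sum.inl v, Sum.inr (Sum.inr b) =>
      if b = true ∧ v ∉ Pset M then M.N * M.xiD v + M.k v / M.RD + M.k v / M.RS else 0
  | Sum.inr (Sum.inl p), Sum.inl q =>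
      if p = q ∧ p ∈ Pset M then M.N * (M.a p / M.RD + M.a p / M.RS) else 0
  | Sum.inr (Sum.inl p), Sum.inr (Sum.inr b) =>
      if b = true ∧ p ∈ Pset M then M.N * M.xiD p + M.k p / M.RD + M.k p / M.RS else 0
  | Sum.inr (Sum.inr b), Sum.inl v =>
      if b = false ∧ v ∉ Pset M then M.N * M.xiS v else 0
  | Sum.inr (Sum.inr b), Sum.inr (Sum.inl p) =>
      if b = false ∧ p ∈ Pset M then M.N * M.xiS p else 0
  | _, _ => 0

/-- An s-t cut of `G'`: a vertex set containing `D` and not `S`. -/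
def IsCutG' {V : Type} (C : Finset (V ⊕ V ⊕ Bool)) : Prop :=
  srcN ∈ C ∧ snkN ∉ C

/-- Value `T_{G'}(C)` of a cut: total weight of edges from inside `C` to outside `C`. -/
noncomputable def cutValG' {V : Type} [Fintype V] (M : SLModel V)
    (C : Finset (V ⊕ V ⊕ Bool)) : ℝ :=
  ∑ x : V ⊕ V ⊕ Bool, ∑ y : V ⊕ V ⊕ Bool, if x ∈ C ∧ y ∉ C then wG' M x y else 0

/-- Splitting induced by a cut `C` of `G'`:
`V_D = {v ∈ V∖P : v ∈ C} ∪ {p ∈ P : p' ∈ C}`. -/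
noncomputable def splitOfCut {V : Type} [Fintype V] (M : SLModel V)
    (C : Finset (V ⊕ V ⊕ Bool)) : Finset V :=
  (Finset.univ \ Pset M).filter (fun v => layerN v ∈ C)
    ∪ (Pset M).filter (fun p => auxN p ∈ C)

/-- `∂`: device-side parents in `P` having a child on the server side. -/
noncomputable def bdryP {V : Type} [Fintype V] (M : SLModel V) (VD : Finset V) : Finset V :=
  (VD ∩ Pset M).filter (fun p => ∃ u, (p, u) ∈ M.E ∧ u ∉ VD)

/-- Cut of `G'` associated to a splitting `V_D`:
`C = {D} ∪ (V_D ∖ ∂) ∪ {p' : p ∈ V_D ∩ P}`. -/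
noncomputable def cutOfSplit {V : Type} [Fintype V] (M : SLModel V) (VD : Finset V) :
    Finset (V ⊕ V ⊕ Bool) :=
  {(srcN : V ⊕ V ⊕ Bool)} ∪ (VD \ bdryP M VD).image layerN ∪ (VD ∩ Pset M).image auxN

theorem layerN_mem_cutOfSplit {V : Type} [Fintype V] (M : SLModel V) (VD : Finset V) (v : V) :
    Sum.inl v ∈ cutOfSplit M VD ↔ v ∈ VD ∧ (v ∈ Pset M → ∀ u, (v, u) ∈ M.E → u ∈ VD) := by
  simp only [cutOfSplit, layerN, auxN, srcN, bdryP, mem_union, mem_singleton, mem_image,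
    mem_sdiff, mem_filter, mem_inter, reduceCtorEq, false_or, and_false, exists_false, or_false,
    Sum.inl.injEq, exists_eq_right]
  grind

theorem auxN_mem_cutOfSplit {V : Type} [Fintype V] (M : SLModel V) (VD : Finset V) (v : V) :
    Sum.inr (Sum.inl v) ∈ cutOfSplit M VD ↔ v ∈ VD ∧ v ∈ Pset M := by
  simp [cutOfSplit, layerN, auxN, srcN]

theorem terminal_mem_cutOfSplit {V : Type} [Fintype V] (M : SLModel V) (VD : Finset V)
    (b : Bool) : Sum.inr (Sum.inr b) ∈ cutOfSplit M VD ↔ b = false := by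
  simp [cutOfSplit, layerN, auxN, srcN]

theorem isCutG'_cutOfSplit {V : Type} [Fintype V] (M : SLModel V) (VD : Finset V) :
    IsCutG' (cutOfSplit M VD) :=
  ⟨(terminal_mem_cutOfSplit M VD false).2 rfl,
    fun h => Bool.noConfusion ((terminal_mem_cutOfSplit M VD true).1 h)⟩

/-- A layer outside `P` has at most one child. -/
theorem child_unique_of_notMem_Pset {V : Type} [Fintype V] (M : SLModel V) {u v w : V}
    (hu : u ∉ Pset M) (hv : (u, v) ∈ M.E) (hw : (u, w) ∈ M.E) : v = w := by
  simp only [Pset, mem_filter, mem_univ, true_and, not_le] at hu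
  have h := card_le_one.1 (Nat.le_of_lt_succ hu) (u, v) (by simp [hv]) (u, w) (by simp [hw])
  exact (Prod.mk.inj h).2

/-- The propagation edges out of the layer vertex `u` that are cut by `cutOfSplit M VD` have
total weight `c` if `u` is a boundary layer outside `P`, and `0` otherwise. -/
theorem sum_propagation_edges_cut {V : Type} [Fintype V] (M : SLModel V) (VD : Finset V)
    (u : V) (c : ℝ) :
    (∑ v, if (u ∈ VD ∧ (u ∈ Pset M → ∀ w, (u, w) ∈ M.E → w ∈ VD)) ∧ v ∉ VD ∧ (u, v) ∈ M.E
      then c else 0) = if u ∈ M.boundary VD ∧ u ∉ Pset M then c else 0 := by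
  simp only [SLModel.boundary, mem_filter]
  split_ifs with h
  · obtain ⟨⟨hu, v, hE, hv⟩, hP⟩ := h
    rw [sum_eq_single v]
    · simp [hu, hE, hv, hP]
    · intro w _ hw
      rw [if_neg]
      rintro ⟨-, -, hE'⟩
      exact hw (child_unique_of_notMem_Pset M hP hE' hE)
    · simp
  · refine sum_eq_zero fun v _ => if_neg ?_
    rintro ⟨⟨hu, hP⟩, hv, hE⟩
    exact h ⟨⟨hu, v, hE, hv⟩, fun hp => hv (hP hp v hE)⟩

/-- The training delay as a sum over layers of execution and propagation delays. -/
theorem SLModel.T_eq_sum {V : Type} [Fintype V] (M : SLModel V) (VD : Finset V) :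
    M.T VD = ∑ v, ((if v ∈ VD then M.N * M.xiD v + M.k v / M.RD + M.k v / M.RS
        else M.N * M.xiS v)
      + if v ∈ M.boundary VD then M.N * (M.a v / M.RD + M.a v / M.RS) else 0) := by
  have hind : ∀ (s : Finset V) (f : V → ℝ), ∑ v ∈ s, f v = ∑ v, if v ∈ s then f v else 0 := by
    simp
  simp only [SLModel.T, hind VD, hind (M.boundary VD), hind (univ \ VD), mul_add, mul_sum,
    ← sum_add_distrib]
  refine sum_congr rfl fun v _ => ?_
  by_cases h : v ∈ VD <;> by_cases h' : v ∈ M.boundary VD <;> simp [h, h'] <;> ring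

theorem cutValG'_cutOfSplit {V : Type} [Fintype V] (M : SLModel V) (VD : Finset V) :
    cutValG' M (cutOfSplit M VD) = M.T VD := by
  rw [SLModel.T_eq_sum]
  simp only [cutValG', Fintype.sum_sum_type, Fintype.sum_bool, wG', layerN_mem_cutOfSplit,
    auxN_mem_cutOfSplit, terminal_mem_cutOfSplit]
  have haux (p : V) : (∑ q, if (p ∈ VD ∧ p ∈ Pset M) ∧
        ¬(q ∈ VD ∧ (q ∈ Pset M → ∀ w, (q, w) ∈ M.E → w ∈ VD)) then
        if p = q ∧ p ∈ Pset M then M.N * (M.a p / M.RD + M.a p / M.RS) else 0 else 0)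
      = if p ∈ M.boundary VD ∧ p ∈ Pset M then M.N * (M.a p / M.RD + M.a p / M.RS) else 0 := by
    rw [sum_eq_single p]
    · grind [SLModel.boundary]
    · grind
    · simp
  have hlayer (u : V) : (∑ v, if (u ∈ VD ∧ (u ∈ Pset M → ∀ w, (u, w) ∈ M.E → w ∈ VD)) ∧
        ¬(v ∈ VD ∧ (v ∈ Pset M → ∀ w, (v, w) ∈ M.E → w ∈ VD)) then
        if (u, v) ∈ M.E ∧ v ∉ Pset M then M.N * (M.a u / M.RD + M.a u / M.RS) else 0 else 0)
      + (∑ v, if (u ∈ VD ∧ (u ∈ Pset M → ∀ w, (u, w) ∈ M.E → w ∈ VD)) ∧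
        ¬(v ∈ VD ∧ v ∈ Pset M) then
        if (u, v) ∈ M.E ∧ v ∈ Pset M then M.N * (M.a u / M.RD + M.a u / M.RS) else 0 else 0)
      = if u ∈ M.boundary VD ∧ u ∉ Pset M then M.N * (M.a u / M.RD + M.a u / M.RS) else 0 := by
    rw [← sum_propagation_edges_cut, ← sum_add_distrib]
    refine sum_congr rfl fun v _ => ?_
    by_cases hv : v ∈ Pset M <;> by_cases hv' : v ∈ VD <;> by_cases hE : (u, v) ∈ M.E <;>
      simp [hv, hv', hE]
  simp only [← add_assoc, haux, hlayer, reduceCtorEq, not_true_eq_false, not_false_eq_true,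
    and_true, true_and, and_false, false_and, if_false, ite_self, sum_const_zero, add_zero,
    zero_add, ← sum_add_distrib]
  refine sum_congr rfl fun v _ => ?_
  by_cases hP : v ∈ Pset M <;> by_cases hv : v ∈ VD <;> by_cases hb : v ∈ M.boundary VD <;>
    simp [hP, hv, hb, add_comm]

/-- **Cut-correspondence half of Theorem 1 (cases 1 and 3).** For every splitting
`V_D`, the set `C = {D} ∪ (V_D ∖ ∂) ∪ {p' : p ∈ V_D ∩ P}` is an s-t cut of `G'`
with `T_{G'}(C) = T(V_D)`; consequently the minimum s-t cut value of `G'` is at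
most the minimum training delay over all splittings. -/
theorem cut_correspondence {V : Type} [Fintype V] (M : SLModel V) (hM : M.Valid) :
    (∀ VD : Finset V,
        IsCutG' (cutOfSplit M VD) ∧ cutValG' M (cutOfSplit M VD) = M.T VD)
    ∧ sInf {x : ℝ | ∃ C : Finset (V ⊕ V ⊕ Bool), IsCutG' C ∧ x = cutValG' M C}
        ≤ sInf {x : ℝ | ∃ VD : Finset V, x = M.T VD} := by
  refine ⟨fun VD => ⟨isCutG'_cutOfSplit M VD, cutValG'_cutOfSplit M VD⟩, ?_⟩
  refine csInf_le_csInf ?_ ⟨_, ∅, rfl⟩ ?_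
  · refine ((Set.finite_range (cutValG' M)).subset ?_).bddBelow
    rintro x ⟨C, -, rfl⟩
    exact ⟨C, rfl⟩
  · rintro x ⟨VD, rfl⟩
    exact ⟨_, isCutG'_cutOfSplit M VD, (cutValG'_cutOfSplit M VD).symm⟩
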